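/- arXiv:2301.00158 — 7 statements merged into one kernel-verified Lean document; each statement's English description precedes it below -/
import Mathlib

section
/- The synergy gap function μ_V(x,ξ) := V(x,ξ) − m_V(x,ξ), valued in (−∞,+∞] (with the convention ∞ − a = ∞ for finite a), is continuous on X × Ξ. -/
open scoped ENNReal

/-- The infimum `m_V(x,ξ) = inf {V(x,g) : g ∈ Q(x,ξ)}`. -/
noncomputable def mVal {n m : ℕ}
    (V : EuclideanSpace ℝ (Fin n) × EuclideanSpace ℝ (Fin m) → ℝ≥0∞)
    (Q : EuclideanSpace ℝ (Fin n) × EuclideanSpace ℝ (Fin m) → Set (EuclideanSpace ℝ (Fin m)))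
    (s : EuclideanSpace ℝ (Fin n) × EuclideanSpace ℝ (Fin m)) : ℝ≥0∞ :=
  ⨅ g ∈ Q s, V (s.1, g)

/-- The synergy gap `μ_V(x,ξ) := V(x,ξ) − m_V(x,ξ)`, valued in `(−∞,+∞]` (as `EReal`,
with the convention `∞ − a = ∞` for finite `a`). -/
noncomputable def muGap {n m : ℕ}
    (V : EuclideanSpace ℝ (Fin n) × EuclideanSpace ℝ (Fin m) → ℝ≥0∞)
    (Q : EuclideanSpace ℝ (Fin n) × EuclideanSpace ℝ (Fin m) → Set (EuclideanSpace ℝ (Fin m)))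
    (s : EuclideanSpace ℝ (Fin n) × EuclideanSpace ℝ (Fin m)) : EReal :=
  (V s : EReal) - (mVal V Q s : EReal)

/-- For a synergistic candidate `(V, Q)`, the synergy gap function
`μ_V = V − m_V` is continuous on `X ×ˢ Ξ`. -/
theorem stmt2 {n m : ℕ}
    (X : Set (EuclideanSpace ℝ (Fin n))) (Ξ : Set (EuclideanSpace ℝ (Fin m)))
    (hXclosed : IsClosed X) (hXne : X.Nonempty)
    (hΞclosed : IsClosed Ξ) (hΞne : Ξ.Nonempty)
    (V : EuclideanSpace ℝ (Fin n) × EuclideanSpace ℝ (Fin m) → ℝ≥0∞)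
    (hV : ContinuousOn V (X ×ˢ Ξ))
    (Q : EuclideanSpace ℝ (Fin n) × EuclideanSpace ℝ (Fin m) → Set (EuclideanSpace ℝ (Fin m)))
    (hQsub : ∀ s ∈ X ×ˢ Ξ, Q s ⊆ Ξ)
    (hQne : ∀ s ∈ X ×ˢ Ξ, (Q s).Nonempty)
    (hQosc : IsClosed {p : (EuclideanSpace ℝ (Fin n) × EuclideanSpace ℝ (Fin m)) ×
        EuclideanSpace ℝ (Fin m) | p.1 ∈ X ×ˢ Ξ ∧ p.2 ∈ Q p.1})
    (hQlb : ∀ s ∈ X ×ˢ Ξ, ∃ U ∈ nhds s, Bornology.IsBounded (⋃ s' ∈ U ∩ (X ×ˢ Ξ), Q s'))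
    (hQlsc : ∀ s ∈ X ×ˢ Ξ, ∀ W : Set (EuclideanSpace ℝ (Fin m)), IsOpen W →
        (Q s ∩ W).Nonempty → ∃ U ∈ nhds s, ∀ s' ∈ U ∩ (X ×ˢ Ξ), (Q s' ∩ W).Nonempty)
    (hfeas : ∀ s ∈ X ×ˢ Ξ, ∃ g ∈ Q s, V (s.1, g) < ⊤) :
    ContinuousOn (muGap V Q) (X ×ˢ Ξ) := by
  intro s hs
  have hVt : Filter.Tendsto V (nhdsWithin s (X ×ˢ Ξ)) (nhds (V s)) := hV s hs
  have hmt : Filter.Tendsto (mVal V Q) (nhdsWithin s (X ×ˢ Ξ)) (nhds (mVal V Q s)) := by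
    rw [tendsto_order]
    constructor
    · intro a ha
      obtain ⟨b, hab, hb⟩ := exists_between ha
      obtain ⟨U, hU, hbd⟩ := hQlb s hs
      have hK := hbd.isCompact_closure
      have key : ∀ᶠ s' in nhds s, ∀ g ∈ closure (⋃ s' ∈ U ∩ (X ×ˢ Ξ), Q s'),
          s' ∈ X ×ˢ Ξ → g ∈ Q s' → b < V (s'.1, g) := by
        refine hK.eventually_forall_of_forall_eventually ?_
        intro g _
        by_cases hg : g ∈ Q s
        · have h1 : b < V (s.1, g) := lt_of_lt_of_le hb (iInf₂_le g hg)
          have hmem : (s.1, g) ∈ X ×ˢ Ξ := ⟨hs.1, hQsub s hs hg⟩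
          have h2 := (hV _ hmem).eventually (lt_mem_nhds h1)
          rw [eventually_nhdsWithin_iff] at h2
          have hc : Filter.Tendsto (fun z : (EuclideanSpace ℝ (Fin n) × EuclideanSpace ℝ (Fin m)) ×
              EuclideanSpace ℝ (Fin m) => (z.1.1, z.2)) (nhds (s, g)) (nhds (s.1, g)) :=
            Continuous.tendsto (by fun_prop) (s, g)
          filter_upwards [hc.eventually h2] with z hz hz1 hz2
          exact hz ⟨hz1.1, hQsub _ hz1 hz2⟩
        · have := hQosc.isOpen_compl.mem_nhds (x := (s, g)) (fun h => hg h.2)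
          filter_upwards [this] with z hz hz1 hz2
          exact absurd ⟨hz1, hz2⟩ hz
      filter_upwards [nhdsWithin_le_nhds key, nhdsWithin_le_nhds hU, self_mem_nhdsWithin]
        with s' h1 h2 h3
      refine lt_of_lt_of_le hab (le_iInf₂ fun g hg => ?_)
      exact (h1 g (subset_closure (Set.mem_biUnion ⟨h2, h3⟩ hg)) h3 hg).le
    · intro a ha
      have : ∃ g ∈ Q s, V (s.1, g) < a := by
        simpa [mVal, iInf_lt_iff] using ha
      obtain ⟨g, hg, hga⟩ := this
      have hmem : (s.1, g) ∈ X ×ˢ Ξ := ⟨hs.1, hQsub s hs hg⟩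
      have h2 := (hV _ hmem).eventually (gt_mem_nhds hga)
      rw [eventually_nhdsWithin_iff, nhds_prod_eq, Filter.eventually_prod_iff] at h2
      obtain ⟨p, hp, q, hq, hpq⟩ := h2
      obtain ⟨W, hWq, hWo, hgW⟩ := eventually_nhds_iff.1 hq
      obtain ⟨U, hU, hUQ⟩ := hQlsc s hs W hWo ⟨g, hg, hgW⟩
      have hp' := (continuous_fst.tendsto s).eventually hp
      filter_upwards [nhdsWithin_le_nhds hp', nhdsWithin_le_nhds hU, self_mem_nhdsWithin]
        with s' h1 h2 h3
      obtain ⟨g', hg', hgW'⟩ := hUQ s' ⟨h2, h3⟩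
      exact lt_of_le_of_lt (iInf₂_le g' hg')
        (hpq h1 (hWq g' hgW') ⟨h3.1, hQsub s' h3 hg'⟩)
  have hfin : mVal V Q s ≠ ⊤ := by
    obtain ⟨g, hg, hlt⟩ := hfeas s hs
    exact (lt_of_le_of_lt (iInf₂_le g hg) hlt).ne
  have h1 := (continuous_coe_ennreal_ereal.tendsto (V s)).comp hVt
  have h2 := (continuous_neg.tendsto _).comp
    ((continuous_coe_ennreal_ereal.tendsto (mVal V Q s)).comp hmt)
  have h3 : ContinuousAt (fun p : EReal × EReal => p.1 + p.2)
      ((V s : EReal), -(mVal V Q s : EReal)) :=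
    EReal.continuousAt_add (Or.inr (by simpa using hfin)) (Or.inl (by simp))
  have h4 := h3.tendsto.comp (h1.prodMk_nhds h2)
  have h5 : ∀ t, muGap V Q t = (V t : EReal) + -(mVal V Q t : EReal) :=
    fun t => sub_eq_add_neg _ _
  rw [ContinuousWithinAt, h5 s, funext h5]
  exact h4
end

section
/- The flow set C := {(x,ξ) ∈ X × Ξ : μ_V(x,ξ) ≤ δ(x,ξ)} and the jump set D := {(x,ξ) ∈ X × Ξ : μ_V(x,ξ) ≥ δ(x,ξ)} are closed relative to X × Ξ, and the closed-loop jump map (x,ξ) ↦ {x} × ρ_V(x,ξ) is outer semicontinuous and locally bounded relative to D. -/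
open scoped ENNReal

/-- The set of minimizers `ρ_V(x,ξ) = {g ∈ Q(x,ξ) : V(x,g) = m_V(x,ξ)}`. -/
noncomputable def rhoSet {n m : ℕ}
    (V : EuclideanSpace ℝ (Fin n) × EuclideanSpace ℝ (Fin m) → ℝ≥0∞)
    (Q : EuclideanSpace ℝ (Fin n) × EuclideanSpace ℝ (Fin m) → Set (EuclideanSpace ℝ (Fin m)))
    (s : EuclideanSpace ℝ (Fin n) × EuclideanSpace ℝ (Fin m)) :
    Set (EuclideanSpace ℝ (Fin m)) :=
  {g ∈ Q s | V (s.1, g) = mVal V Q s}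

theorem mVal_contOn {n m : ℕ}
    (X : Set (EuclideanSpace ℝ (Fin n))) (Ξ : Set (EuclideanSpace ℝ (Fin m)))
    (V : EuclideanSpace ℝ (Fin n) × EuclideanSpace ℝ (Fin m) → ℝ≥0∞)
    (hV : ContinuousOn V (X ×ˢ Ξ))
    (Q : EuclideanSpace ℝ (Fin n) × EuclideanSpace ℝ (Fin m) → Set (EuclideanSpace ℝ (Fin m)))
    (hQsub : ∀ s ∈ X ×ˢ Ξ, Q s ⊆ Ξ)
    (hQosc : IsClosed {p : (EuclideanSpace ℝ (Fin n) × EuclideanSpace ℝ (Fin m)) ×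
        EuclideanSpace ℝ (Fin m) | p.1 ∈ X ×ˢ Ξ ∧ p.2 ∈ Q p.1})
    (hQlb : ∀ s ∈ X ×ˢ Ξ, ∃ U ∈ nhds s, Bornology.IsBounded (⋃ s' ∈ U ∩ (X ×ˢ Ξ), Q s'))
    (hQlsc : ∀ s ∈ X ×ˢ Ξ, ∀ W : Set (EuclideanSpace ℝ (Fin m)), IsOpen W →
        (Q s ∩ W).Nonempty → ∃ U ∈ nhds s, ∀ s' ∈ U ∩ (X ×ˢ Ξ), (Q s' ∩ W).Nonempty) :
    ContinuousOn (mVal V Q) (X ×ˢ Ξ) := by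
  intro s hs
  refine tendsto_order.2 ⟨?_, ?_⟩
  · intro c hc
    obtain ⟨c', hcc', hc'⟩ := exists_between hc
    obtain ⟨U, hU, hb⟩ := hQlb s hs
    have hK := hb.isCompact_closure
    have key := hK.eventually_forall_of_forall_eventually (x₀ := s)
      (P := fun s' g => s' ∈ X ×ˢ Ξ → g ∈ Q s' → c' < V (s'.1, g)) (by
        intro g _
        by_cases hg : g ∈ Q s
        · have hin : (s.1, g) ∈ X ×ˢ Ξ := ⟨hs.1, hQsub s hs hg⟩
          have h1 : c' < V (s.1, g) := hc'.trans_le (iInf₂_le g hg)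
          have h2 := (hV _ hin).eventually (lt_mem_nhds h1)
          rw [eventually_nhdsWithin_iff] at h2
          have h3 : Filter.Tendsto (fun z : (EuclideanSpace ℝ (Fin n) × EuclideanSpace ℝ (Fin m)) ×
              EuclideanSpace ℝ (Fin m) => (z.1.1, z.2)) (nhds (s, g)) (nhds (s.1, g)) :=
            Continuous.tendsto (by fun_prop) (s, g)
          filter_upwards [h3.eventually h2] with z hz hzs hzq
          exact hz ⟨hzs.1, hQsub _ hzs hzq⟩
        · have := hQosc.isOpen_compl.mem_nhds (x := (s, g)) (fun h => hg h.2)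
          filter_upwards [this] with z hz hzs hzq
          exact absurd ⟨hzs, hzq⟩ hz)
    filter_upwards [mem_nhdsWithin_of_mem_nhds key, mem_nhdsWithin_of_mem_nhds hU,
      self_mem_nhdsWithin] with s' h1 h2 h3
    refine hcc'.trans_le (le_iInf₂ fun g hg => (h1 g (subset_closure ?_) h3 hg).le)
    exact Set.mem_biUnion (⟨h2, h3⟩ : s' ∈ U ∩ (X ×ˢ Ξ)) hg
  · intro c hc
    obtain ⟨g, hg, hgc⟩ : ∃ g ∈ Q s, V (s.1, g) < c := by
      simpa [mVal, iInf_lt_iff] using hc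
    have hin : (s.1, g) ∈ X ×ˢ Ξ := ⟨hs.1, hQsub s hs hg⟩
    have h2 := (hV _ hin).eventually (gt_mem_nhds hgc)
    rw [eventually_nhdsWithin_iff] at h2
    obtain ⟨A, W, hA, hsA, hW, hgW, hAW⟩ := mem_nhds_prod_iff'.1 h2
    obtain ⟨U, hU, hUW⟩ := hQlsc s hs W hW ⟨g, hg, hgW⟩
    have hA' : ∀ᶠ s' in nhds s, s'.1 ∈ A := continuous_fst.continuousAt.eventually (hA.mem_nhds hsA)
    filter_upwards [mem_nhdsWithin_of_mem_nhds hA', mem_nhdsWithin_of_mem_nhds hU,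
      self_mem_nhdsWithin] with s' h1 h2 h3
    obtain ⟨g', hg', hg'W⟩ := hUW s' ⟨h2, h3⟩
    exact (iInf₂_le g' hg').trans_lt (hAW (Set.mk_mem_prod h1 hg'W) ⟨h3.1, hQsub _ h3 hg'⟩)

theorem closed_le_on {α β : Type*} [TopologicalSpace α] [TopologicalSpace β] [Preorder β]
    [OrderClosedTopology β] {S : Set α} (hS : IsClosed S) {f g : α → β}
    (hf : ContinuousOn f S) (hg : ContinuousOn g S) : IsClosed {s ∈ S | f s ≤ g s} :=
  hS.isClosed_le hf hg

/-- For a synergistic candidate `(V, Q)` and a continuous `δ`, the flow set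
`C = {(x,ξ) ∈ X × Ξ : μ_V ≤ δ}` and the jump set `D = {(x,ξ) ∈ X × Ξ : μ_V ≥ δ}` are closed,
and the closed-loop jump map `(x,ξ) ↦ {x} × ρ_V(x,ξ)` is outer semicontinuous (closed graph)
and locally bounded relative to `D`. -/
theorem stmt3 {n m : ℕ}
    (X : Set (EuclideanSpace ℝ (Fin n))) (Ξ : Set (EuclideanSpace ℝ (Fin m)))
    (hXclosed : IsClosed X) (hXne : X.Nonempty)
    (hΞclosed : IsClosed Ξ) (hΞne : Ξ.Nonempty)
    (V : EuclideanSpace ℝ (Fin n) × EuclideanSpace ℝ (Fin m) → ℝ≥0∞)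
    (hV : ContinuousOn V (X ×ˢ Ξ))
    (Q : EuclideanSpace ℝ (Fin n) × EuclideanSpace ℝ (Fin m) → Set (EuclideanSpace ℝ (Fin m)))
    (hQsub : ∀ s ∈ X ×ˢ Ξ, Q s ⊆ Ξ)
    (hQne : ∀ s ∈ X ×ˢ Ξ, (Q s).Nonempty)
    (hQosc : IsClosed {p : (EuclideanSpace ℝ (Fin n) × EuclideanSpace ℝ (Fin m)) ×
        EuclideanSpace ℝ (Fin m) | p.1 ∈ X ×ˢ Ξ ∧ p.2 ∈ Q p.1})
    (hQlb : ∀ s ∈ X ×ˢ Ξ, ∃ U ∈ nhds s, Bornology.IsBounded (⋃ s' ∈ U ∩ (X ×ˢ Ξ), Q s'))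
    (hQlsc : ∀ s ∈ X ×ˢ Ξ, ∀ W : Set (EuclideanSpace ℝ (Fin m)), IsOpen W →
        (Q s ∩ W).Nonempty → ∃ U ∈ nhds s, ∀ s' ∈ U ∩ (X ×ˢ Ξ), (Q s' ∩ W).Nonempty)
    (hfeas : ∀ s ∈ X ×ˢ Ξ, ∃ g ∈ Q s, V (s.1, g) < ⊤)
    (δ : EuclideanSpace ℝ (Fin n) × EuclideanSpace ℝ (Fin m) → ℝ)
    (hδ : ContinuousOn δ (X ×ˢ Ξ)) :
    IsClosed {s ∈ X ×ˢ Ξ | muGap V Q s ≤ (δ s : EReal)} ∧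
    IsClosed {s ∈ X ×ˢ Ξ | (δ s : EReal) ≤ muGap V Q s} ∧
    IsClosed {p : (EuclideanSpace ℝ (Fin n) × EuclideanSpace ℝ (Fin m)) ×
        (EuclideanSpace ℝ (Fin n) × EuclideanSpace ℝ (Fin m)) |
        (p.1 ∈ X ×ˢ Ξ ∧ (δ p.1 : EReal) ≤ muGap V Q p.1) ∧
          p.2.1 = p.1.1 ∧ p.2.2 ∈ rhoSet V Q p.1} ∧
    (∀ s ∈ {s ∈ X ×ˢ Ξ | (δ s : EReal) ≤ muGap V Q s}, ∃ U ∈ nhds s,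
        Bornology.IsBounded (⋃ s' ∈ U ∩ {s ∈ X ×ˢ Ξ | (δ s : EReal) ≤ muGap V Q s},
          {s'.1} ×ˢ rhoSet V Q s')) := by
  have hS : IsClosed (X ×ˢ Ξ) := hXclosed.prod hΞclosed
  have hm := mVal_contOn X Ξ V hV Q hQsub hQosc hQlb hQlsc
  have hfin : ∀ s ∈ X ×ˢ Ξ, mVal V Q s ≠ ⊤ := by
    intro s hs
    obtain ⟨g, hg, h⟩ := hfeas s hs
    exact ((iInf₂_le g hg).trans_lt h).ne
  have hmu : ContinuousOn (muGap V Q) (X ×ˢ Ξ) := by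
    intro s hs
    have h1 : ContinuousWithinAt (fun s => (V s : EReal)) (X ×ˢ Ξ) s :=
      continuous_coe_ennreal_ereal.continuousAt.comp_continuousWithinAt (hV s hs)
    have h2 : ContinuousWithinAt (fun s => -(mVal V Q s : EReal)) (X ×ˢ Ξ) s :=
      (continuous_neg.comp continuous_coe_ennreal_ereal).continuousAt.comp_continuousWithinAt
        (hm s hs)
    have h3 : ContinuousAt (fun p : EReal × EReal => p.1 + p.2)
        ((V s : EReal), -(mVal V Q s : EReal)) := by
      apply EReal.continuousAt_add
      · right
        simpa using hfin s hs
      · left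
        simp
    exact h3.comp_continuousWithinAt (f := fun s => ((V s : EReal), -(mVal V Q s : EReal)))
      (h1.prodMk h2)
  have hd : ContinuousOn (fun s => (δ s : EReal)) (X ×ˢ Ξ) :=
    continuous_coe_real_ereal.comp_continuousOn hδ
  have hD := closed_le_on hS hd hmu
  refine ⟨closed_le_on hS hmu hd, hD, ?_, ?_⟩
  · have c1 : Continuous (fun p : (EuclideanSpace ℝ (Fin n) × EuclideanSpace ℝ (Fin m)) ×
        (EuclideanSpace ℝ (Fin n) × EuclideanSpace ℝ (Fin m)) => (p.1, p.2.2)) := by fun_prop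
    have hG := hQosc.preimage c1
    have hE := closed_le_on (β := ℝ≥0∞) hG
      (f := fun p => V (p.1.1, p.2.2)) (g := fun p => mVal V Q p.1)
      (hV.comp (Continuous.continuousOn (by fun_prop))
        (fun p hp => ⟨hp.1.1, hQsub _ hp.1 hp.2⟩))
      (hm.comp continuous_fst.continuousOn (fun p hp => hp.1))
    have hF := isClosed_eq (f := fun p : (EuclideanSpace ℝ (Fin n) × EuclideanSpace ℝ (Fin m)) ×
        (EuclideanSpace ℝ (Fin n) × EuclideanSpace ℝ (Fin m)) => p.2.1) (g := fun p => p.1.1)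
        (by fun_prop) (by fun_prop)
    convert (hD.preimage continuous_fst).inter (hF.inter hE) using 1
    ext p
    constructor
    · rintro ⟨h1, h2, h3, h4⟩
      exact ⟨h1, h2, ⟨h1.1, h3⟩, h4.le⟩
    · rintro ⟨h1, h2, ⟨_, h3⟩, h4⟩
      exact ⟨h1, h2, h3, le_antisymm h4 (iInf₂_le _ h3)⟩
  · intro s hs
    obtain ⟨U, hU, hb⟩ := hQlb s hs.1
    refine ⟨U ∩ Metric.ball s 1, Filter.inter_mem hU (Metric.ball_mem_nhds s one_pos), ?_⟩
    refine ((Metric.isBounded_ball (x := s.1) (r := 1)).prod hb).subset ?_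
    refine Set.iUnion₂_subset ?_
    rintro s' ⟨⟨h1, h2⟩, h3⟩ ⟨a, g⟩ ⟨ha, hg⟩
    refine ⟨?_, Set.mem_biUnion (⟨h1, h3.1⟩ : s' ∈ U ∩ (X ×ˢ Ξ)) hg.1⟩
    have ha' : a = s'.1 := ha
    subst ha'
    exact (le_max_left _ _).trans_lt (show dist s' s < 1 from h2)
end

section
/- For each θ̂ with ‖θ̂‖ ≤ θ₀+ε, the set Ĝ(θ̂) of maximizers over g ∈ {g : ‖g‖ ≤ θ₀+ε} of the function g ↦ min_{θ∈Ω} h_{θ̂}(g,θ) is nonempty and compact, the set-valued map θ̂ ↦ Ĝ(θ̂) is outer semicontinuous (has closed graph) and locally bounded, and for every θ ∈ Ω, every (x,ξ,θ̂), every minimizer g₀ of V₀(x,·) over Q_c(x,ξ), and every ĝ ∈ Ĝ(θ̂): V₁(x,ξ,θ̂) − V₁(x,g₀,ĝ) ≥ μ_{V₀}(x,ξ) + (1/2) min_{θ'∈Ω} (θ'−θ̂)ᵀΓ₁⁻¹(θ'−θ̂), the right-hand side being the minimum over θ' ∈ Ω of the synergy gap of V₁ with parameter θ'. -/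
open scoped ENNReal
open Matrix

/-- The quadratic form `v ↦ vᵀ A v` on Euclidean space. -/
noncomputable def quadForm {l : ℕ} (A : Matrix (Fin l) (Fin l) ℝ)
    (v : EuclideanSpace ℝ (Fin l)) : ℝ :=
  (fun i => v i) ⬝ᵥ A.mulVec (fun i => v i)

/-- `h_{θ̂}(g,θ) := (θ−θ̂)ᵀΓ₁⁻¹(θ−θ̂) − (θ−g)ᵀΓ₁⁻¹(θ−g)`. -/
noncomputable def hFun {l : ℕ} (Γ₁ : Matrix (Fin l) (Fin l) ℝ)
    (θh g θ : EuclideanSpace ℝ (Fin l)) : ℝ :=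
  quadForm Γ₁⁻¹ (θ - θh) - quadForm Γ₁⁻¹ (θ - g)

/-- `g ↦ min_{θ ∈ Ω} h_{θ̂}(g,θ)` with `Ω := {θ : ‖θ‖ ≤ θ₀}`. -/
noncomputable def minhFun {l : ℕ} (Γ₁ : Matrix (Fin l) (Fin l) ℝ) (θ₀ : ℝ)
    (θh g : EuclideanSpace ℝ (Fin l)) : ℝ :=
  sInf ((fun θ => hFun Γ₁ θh g θ) '' Metric.closedBall (0 : EuclideanSpace ℝ (Fin l)) θ₀)

/-- `Ĝ(θ̂)`: the maximizers of `g ↦ min_{θ∈Ω} h_{θ̂}(g,θ)` over `{g : ‖g‖ ≤ θ₀+ε}`. -/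
noncomputable def Ghat {l : ℕ} (Γ₁ : Matrix (Fin l) (Fin l) ℝ) (θ₀ ε : ℝ)
    (θh : EuclideanSpace ℝ (Fin l)) : Set (EuclideanSpace ℝ (Fin l)) :=
  {g ∈ Metric.closedBall (0 : EuclideanSpace ℝ (Fin l)) (θ₀ + ε) |
    ∀ g' ∈ Metric.closedBall (0 : EuclideanSpace ℝ (Fin l)) (θ₀ + ε),
      minhFun Γ₁ θ₀ θh g' ≤ minhFun Γ₁ θ₀ θh g}

/-- The adaptive Lyapunov function
`V₁(x,ξ,θ̂) := V₀(x,ξ) + (1/2)(θ−θ̂)ᵀ Γ₁⁻¹ (θ−θ̂)`. -/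
noncomputable def V1fun {n m l : ℕ}
    (V₀ : EuclideanSpace ℝ (Fin n) × EuclideanSpace ℝ (Fin m) → ℝ≥0∞)
    (Γ₁ : Matrix (Fin l) (Fin l) ℝ) (θ : EuclideanSpace ℝ (Fin l))
    (x : EuclideanSpace ℝ (Fin n)) (ξ : EuclideanSpace ℝ (Fin m))
    (θh : EuclideanSpace ℝ (Fin l)) : ℝ≥0∞ :=
  V₀ (x, ξ) + ENNReal.ofReal ((1 / 2) * quadForm Γ₁⁻¹ (θ - θh))


lemma quadForm_cont {l : ℕ} (A : Matrix (Fin l) (Fin l) ℝ) : Continuous (quadForm A) := by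
  unfold quadForm
  simp only [dotProduct, Matrix.mulVec]
  fun_prop

lemma quadForm_nonneg {l : ℕ} {A : Matrix (Fin l) (Fin l) ℝ} (hA : A.PosDef)
    (v : EuclideanSpace ℝ (Fin l)) : 0 ≤ quadForm A v := by
  have h := hA.posSemidef.dotProduct_mulVec_nonneg (fun i => v i)
  simpa [quadForm] using h

lemma quadForm_add_smul {l : ℕ} {A : Matrix (Fin l) (Fin l) ℝ} (hA : A.PosDef)
    (a w : EuclideanSpace ℝ (Fin l)) : ∃ B : ℝ, ∀ t : ℝ,
    quadForm A (a + t • w) = quadForm A a + 2 * t * B + t ^ 2 * quadForm A w := by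
  refine ⟨(fun i => a i) ⬝ᵥ A.mulVec (fun i => w i), fun t => ?_⟩
  have hs : (fun i => w i) ⬝ᵥ A.mulVec (fun i => a i)
      = (fun i => a i) ⬝ᵥ A.mulVec (fun i => w i) := by
    have hT : Aᵀ = A := by
      have := hA.isHermitian.eq
      rwa [Matrix.conjTranspose_eq_transpose_of_trivial] at this
    rw [Matrix.dotProduct_mulVec, ← Matrix.mulVec_transpose, hT, dotProduct_comm]
  have e : (fun i => (a + t • w) i) = (fun i => a i) + t • (fun i => w i) := by
    ext i; simp
  unfold quadForm
  rw [e, Matrix.mulVec_add, Matrix.mulVec_smul, add_dotProduct, dotProduct_add, dotProduct_add,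
    smul_dotProduct, smul_dotProduct, dotProduct_smul, dotProduct_smul, hs]
  simp only [smul_eq_mul]
  ring

lemma proj_ineq {l : ℕ} {A : Matrix (Fin l) (Fin l) ℝ} (hA : A.PosDef)
    {K : Set (EuclideanSpace ℝ (Fin l))} (hK : Convex ℝ K) {θh g θ : EuclideanSpace ℝ (Fin l)}
    (hg : g ∈ K) (hθ : θ ∈ K) (hmin : ∀ θ' ∈ K, quadForm A (g - θh) ≤ quadForm A (θ' - θh)) :
    quadForm A (g - θh) ≤ quadForm A (θ - θh) - quadForm A (θ - g) := by
  obtain ⟨B, hB⟩ := quadForm_add_smul hA (g - θh) (θ - g)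
  have h1 := hB 1
  have e1 : g - θh + (1 : ℝ) • (θ - g) = θ - θh := by rw [one_smul]; abel
  rw [e1] at h1
  have key : ∀ t : ℝ, 0 < t → t ≤ 1 → 0 ≤ 2 * B + t * quadForm A (θ - g) := by
    intro t ht0 ht1
    have hm := hmin (g + t • (θ - g)) (hK.add_smul_sub_mem hg hθ ⟨ht0.le, ht1⟩)
    have e2 : g + t • (θ - g) - θh = g - θh + t • (θ - g) := by abel
    rw [e2, hB t] at hm
    by_contra hc
    push Not at hc
    nlinarith
  have hB0 : 0 ≤ B := by
    by_contra hc
    push Not at hc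
    have hq := quadForm_nonneg hA (θ - g)
    set q := quadForm A (θ - g)
    have hpos : 0 < q + (-B) := by linarith
    have := key ((-B) / (q + (-B))) (by apply div_pos <;> linarith)
      (by rw [div_le_one hpos]; linarith)
    have h3 : (-B) / (q + (-B)) * q ≤ -B := by
      rw [div_mul_eq_mul_div, div_le_iff₀ hpos]; nlinarith
    linarith
  linarith

lemma hFun_cont {l : ℕ} (Γ₁ : Matrix (Fin l) (Fin l) ℝ) :
    Continuous (fun p : (EuclideanSpace ℝ (Fin l) × EuclideanSpace ℝ (Fin l)) ×
      EuclideanSpace ℝ (Fin l) => hFun Γ₁ p.1.1 p.1.2 p.2) := by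
  have := quadForm_cont Γ₁⁻¹
  unfold hFun
  fun_prop

lemma minhFun_cont {l : ℕ} (Γ₁ : Matrix (Fin l) (Fin l) ℝ) (θ₀ : ℝ) :
    Continuous (fun p : EuclideanSpace ℝ (Fin l) × EuclideanSpace ℝ (Fin l) =>
      minhFun Γ₁ θ₀ p.1 p.2) := by
  have h := IsCompact.continuous_sInf
    (f := fun (p : EuclideanSpace ℝ (Fin l) × EuclideanSpace ℝ (Fin l))
      (θ : EuclideanSpace ℝ (Fin l)) => hFun Γ₁ p.1 p.2 θ)
    (isCompact_closedBall (0 : EuclideanSpace ℝ (Fin l)) θ₀) (hFun_cont Γ₁)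
  exact h

lemma minhFun_cont_right {l : ℕ} (Γ₁ : Matrix (Fin l) (Fin l) ℝ) (θ₀ : ℝ)
    (θh : EuclideanSpace ℝ (Fin l)) : Continuous (fun g => minhFun Γ₁ θ₀ θh g) := by
  have h2 : Continuous (fun g : EuclideanSpace ℝ (Fin l) => (θh, g)) := by fun_prop
  have h := (minhFun_cont Γ₁ θ₀).comp h2
  simpa only [Function.comp_def] using h

lemma ghat_graph_closed {l : ℕ} (Γ₁ : Matrix (Fin l) (Fin l) ℝ) (θ₀ ε : ℝ) :
    IsClosed {p : EuclideanSpace ℝ (Fin l) × EuclideanSpace ℝ (Fin l) |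
        p.2 ∈ Ghat Γ₁ θ₀ ε p.1} := by
  have hc := minhFun_cont Γ₁ θ₀
  have e : {p : EuclideanSpace ℝ (Fin l) × EuclideanSpace ℝ (Fin l) |
        p.2 ∈ Ghat Γ₁ θ₀ ε p.1} = (Prod.snd ⁻¹' Metric.closedBall 0 (θ₀ + ε)) ∩
      ⋂ g' : EuclideanSpace ℝ (Fin l), ⋂ _ : g' ∈ Metric.closedBall 0 (θ₀ + ε),
        {p : EuclideanSpace ℝ (Fin l) × EuclideanSpace ℝ (Fin l) |
          minhFun Γ₁ θ₀ p.1 g' ≤ minhFun Γ₁ θ₀ p.1 p.2} := by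
    ext p
    simp [Ghat]
  rw [e]
  refine IsClosed.inter (Metric.isClosed_closedBall.preimage continuous_snd) ?_
  refine isClosed_iInter fun g' => isClosed_iInter fun _ => isClosed_le ?_ hc
  exact hc.comp (Continuous.prodMk continuous_fst continuous_const)

lemma ghat_real {l : ℕ} (Γ₁ : Matrix (Fin l) (Fin l) ℝ) (hΓ₁ : Γ₁.PosDef)
    (θ₀ ε : ℝ) (hθ₀ : 0 < θ₀) (hε : 0 < ε) (θ θh gh : EuclideanSpace ℝ (Fin l))
    (hθ : θ ∈ Metric.closedBall (0 : EuclideanSpace ℝ (Fin l)) θ₀)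
    (hgh : gh ∈ Ghat Γ₁ θ₀ ε θh) :
    sInf ((fun θ' => quadForm Γ₁⁻¹ (θ' - θh)) ''
            Metric.closedBall (0 : EuclideanSpace ℝ (Fin l)) θ₀)
      ≤ quadForm Γ₁⁻¹ (θ - θh) - quadForm Γ₁⁻¹ (θ - gh) := by
  have hK := isCompact_closedBall (0 : EuclideanSpace ℝ (Fin l)) θ₀
  have hne : (Metric.closedBall (0 : EuclideanSpace ℝ (Fin l)) θ₀).Nonempty := ⟨θ, hθ⟩
  have hq := quadForm_cont Γ₁⁻¹
  have hc1 : Continuous (fun θ' => quadForm Γ₁⁻¹ (θ' - θh)) := by fun_prop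
  obtain ⟨g, hg, hmin⟩ := hK.exists_isMinOn hne hc1.continuousOn
  have hmin' : ∀ θ' ∈ Metric.closedBall (0 : EuclideanSpace ℝ (Fin l)) θ₀,
      quadForm Γ₁⁻¹ (g - θh) ≤ quadForm Γ₁⁻¹ (θ' - θh) := fun θ' h => hmin h
  have h1 : sInf ((fun θ' => quadForm Γ₁⁻¹ (θ' - θh)) ''
            Metric.closedBall (0 : EuclideanSpace ℝ (Fin l)) θ₀) ≤ quadForm Γ₁⁻¹ (g - θh) :=
    csInf_le (hK.image hc1).bddBelow ⟨g, hg, rfl⟩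
  have h2 : quadForm Γ₁⁻¹ (g - θh) ≤ minhFun Γ₁ θ₀ θh g := by
    refine le_csInf (hne.image _) ?_
    rintro _ ⟨θ', hθ', rfl⟩
    exact proj_ineq hΓ₁.inv (convex_closedBall _ _) hg hθ' hmin'
  have h3 : minhFun Γ₁ θ₀ θh g ≤ minhFun Γ₁ θ₀ θh gh :=
    hgh.2 g (Metric.closedBall_subset_closedBall (by linarith) hg)
  have hc2 : Continuous (fun θ' => hFun Γ₁ θh gh θ') := by
    unfold hFun; fun_prop
  have h4 : minhFun Γ₁ θ₀ θh gh ≤ hFun Γ₁ θh gh θ :=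
    csInf_le (hK.image hc2).bddBelow ⟨θ, hθ, rfl⟩
  exact h1.trans (h2.trans (h3.trans h4))

lemma ereal_fin (u v : ℝ≥0∞) (hfin : v ≠ ⊤) (s a b : ℝ) (p1 : 0 ≤ a) (p2 : 0 ≤ b)
    (hr : s ≤ a - b) :
    ((u : EReal) - (v : EReal)) + (((1 / 2) * s : ℝ) : EReal) ≤
      ((u + ENNReal.ofReal ((1 / 2) * a) : ℝ≥0∞) : EReal) -
        ((v + ENNReal.ofReal ((1 / 2) * b) : ℝ≥0∞) : EReal) := by
  have conv : ∀ (w : ℝ≥0∞) (c : ℝ), w ≠ ⊤ → 0 ≤ c →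
      ((w + ENNReal.ofReal ((1 / 2) * c) : ℝ≥0∞) : EReal)
        = ((w.toReal + (1 / 2) * c : ℝ) : EReal) := by
    intro w c hw hc
    rw [EReal.coe_ennreal_add, ← EReal.coe_ennreal_toReal hw, EReal.coe_ennreal_ofReal,
      max_eq_left (by positivity), ← EReal.coe_add]
  rw [conv v b hfin p2]
  by_cases hu : u = ⊤
  · subst hu
    rw [top_add, EReal.coe_ennreal_top, EReal.top_sub_coe]
    exact le_top
  · rw [conv u a hu p1, ← EReal.coe_ennreal_toReal hu, ← EReal.coe_ennreal_toReal hfin]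
    norm_cast
    linarith

/-- For each `θ̂` with `‖θ̂‖ ≤ θ₀+ε`, the set `Ĝ(θ̂)` of maximizers is
nonempty and compact, the map `θ̂ ↦ Ĝ(θ̂)` is outer semicontinuous (closed graph) and locally
bounded, and for every `θ ∈ Ω`, every `(x,ξ,θ̂)`, every minimizer `g₀` of `V₀(x,·)` over
`Q_c(x,ξ)` and every `ĝ ∈ Ĝ(θ̂)`:
`V₁(x,ξ,θ̂) − V₁(x,g₀,ĝ) ≥ μ_{V₀}(x,ξ) + (1/2) min_{θ'∈Ω} (θ'−θ̂)ᵀΓ₁⁻¹(θ'−θ̂)`. -/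
theorem stmt11 {n m l : ℕ}
    (V₀ : EuclideanSpace ℝ (Fin n) × EuclideanSpace ℝ (Fin m) → ℝ≥0∞)
    (hV₀cont : Continuous V₀)
    (Qc : EuclideanSpace ℝ (Fin n) × EuclideanSpace ℝ (Fin m) →
      Set (EuclideanSpace ℝ (Fin m)))
    (hQcne : ∀ s, (Qc s).Nonempty)
    (hQcmin : ∀ s, ∃ g ∈ Qc s, V₀ (s.1, g) ≠ ⊤ ∧ ∀ g' ∈ Qc s, V₀ (s.1, g) ≤ V₀ (s.1, g'))
    (Γ₁ : Matrix (Fin l) (Fin l) ℝ) (hΓ₁ : Γ₁.PosDef)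
    (θ₀ ε : ℝ) (hθ₀ : 0 < θ₀) (hε : 0 < ε) :
    (∀ θh ∈ Metric.closedBall (0 : EuclideanSpace ℝ (Fin l)) (θ₀ + ε),
      (Ghat Γ₁ θ₀ ε θh).Nonempty ∧ IsCompact (Ghat Γ₁ θ₀ ε θh)) ∧
    IsClosed {p : EuclideanSpace ℝ (Fin l) × EuclideanSpace ℝ (Fin l) |
      p.1 ∈ Metric.closedBall (0 : EuclideanSpace ℝ (Fin l)) (θ₀ + ε) ∧
        p.2 ∈ Ghat Γ₁ θ₀ ε p.1} ∧
    (∀ θh ∈ Metric.closedBall (0 : EuclideanSpace ℝ (Fin l)) (θ₀ + ε), ∃ U ∈ nhds θh,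
      Bornology.IsBounded
        (⋃ θh' ∈ U ∩ Metric.closedBall (0 : EuclideanSpace ℝ (Fin l)) (θ₀ + ε),
          Ghat Γ₁ θ₀ ε θh')) ∧
    ∀ θ ∈ Metric.closedBall (0 : EuclideanSpace ℝ (Fin l)) θ₀,
    ∀ (x : EuclideanSpace ℝ (Fin n)) (ξ : EuclideanSpace ℝ (Fin m)),
    ∀ θh ∈ Metric.closedBall (0 : EuclideanSpace ℝ (Fin l)) (θ₀ + ε),
    ∀ g₀ ∈ Qc (x, ξ), (∀ g' ∈ Qc (x, ξ), V₀ (x, g₀) ≤ V₀ (x, g')) →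
    ∀ gh ∈ Ghat Γ₁ θ₀ ε θh,
      ((V₀ (x, ξ) : EReal) - ((⨅ g ∈ Qc (x, ξ), V₀ (x, g) : ℝ≥0∞) : EReal)) +
          (((1 / 2) * sInf ((fun θ' => quadForm Γ₁⁻¹ (θ' - θh)) ''
            Metric.closedBall (0 : EuclideanSpace ℝ (Fin l)) θ₀) : ℝ) : EReal)
        ≤ (V1fun V₀ Γ₁ θ x ξ θh : EReal) - (V1fun V₀ Γ₁ θ x g₀ gh : EReal) := by
  have hB := isCompact_closedBall (0 : EuclideanSpace ℝ (Fin l)) (θ₀ + ε)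
  have hcl := ghat_graph_closed Γ₁ θ₀ ε
  refine ⟨fun θh hθh => ⟨?_, ?_⟩, ?_, fun θh hθh => ⟨Set.univ, Filter.univ_mem, ?_⟩, ?_⟩
  · have hc : Continuous (fun g => minhFun Γ₁ θ₀ θh g) :=
      minhFun_cont_right Γ₁ θ₀ θh
    obtain ⟨g, hg, hmax⟩ := hB.exists_isMaxOn ⟨θh, hθh⟩ hc.continuousOn
    exact ⟨g, hg, fun g' hg' => hmax hg'⟩
  · refine hB.of_isClosed_subset ?_ (fun g hg => hg.1)
    have h2 : Continuous (fun g : EuclideanSpace ℝ (Fin l) => (θh, g)) := by fun_prop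
    exact hcl.preimage h2
  · exact (Metric.isClosed_closedBall.preimage continuous_fst).inter hcl
  · refine hB.isBounded.subset ?_
    intro g hg
    simp only [Set.mem_iUnion] at hg
    obtain ⟨_, _, h⟩ := hg
    exact h.1
  · intro θ hθ x ξ θh hθh g₀ hg₀ hmin gh hgh
    have hr := ghat_real Γ₁ hΓ₁ θ₀ ε hθ₀ hε θ θh gh hθ hgh
    have hinf : (⨅ g ∈ Qc (x, ξ), V₀ (x, g)) = V₀ (x, g₀) :=
      le_antisymm (iInf₂_le g₀ hg₀) (le_iInf₂ hmin)
    have hfin : V₀ (x, g₀) ≠ ⊤ := by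
      obtain ⟨g, hg, hgt, _⟩ := hQcmin (x, ξ)
      exact ne_top_of_le_ne_top hgt (hmin g hg)
    have p1 := quadForm_nonneg hΓ₁.inv (θ - θh)
    have p2 := quadForm_nonneg hΓ₁.inv (θ - gh)
    rw [hinf]
    unfold V1fun
    exact ereal_fin _ _ hfin _ _ _ p1 p2 hr
end

section
/- For every θ̂ ∈ ℝ^ℓ with ‖θ̂‖ ≤ θ₀+ε, the set of maximizers over g in the closed ball {g ∈ ℝ^ℓ : ‖g‖ ≤ θ₀+ε} of the function g ↦ min_{‖θ‖≤θ₀} (‖θ−θ̂‖² − ‖θ−g‖²) is the singleton {θ̂} if ‖θ̂‖ ≤ θ₀, and the singleton {θ₀ θ̂/‖θ̂‖} if ‖θ̂‖ > θ₀. -/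
/-- The set of maximizers over the closed ball `{g : ‖g‖ ≤ θ₀+ε}` of
`g ↦ min_{‖θ‖ ≤ θ₀} (‖θ−θ̂‖² − ‖θ−g‖²)` (the jump map `Ĝ(θ̂)` with `Γ₁ = I`). -/
noncomputable def argmaxSet {l : ℕ} (θ₀ ε : ℝ)
    (θh : EuclideanSpace ℝ (Fin l)) : Set (EuclideanSpace ℝ (Fin l)) :=
  {g ∈ Metric.closedBall (0 : EuclideanSpace ℝ (Fin l)) (θ₀ + ε) |
    ∀ g' ∈ Metric.closedBall (0 : EuclideanSpace ℝ (Fin l)) (θ₀ + ε),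
      sInf ((fun θ => ‖θ - θh‖ ^ 2 - ‖θ - g'‖ ^ 2) ''
          Metric.closedBall (0 : EuclideanSpace ℝ (Fin l)) θ₀) ≤
        sInf ((fun θ => ‖θ - θh‖ ^ 2 - ‖θ - g‖ ^ 2) ''
          Metric.closedBall (0 : EuclideanSpace ℝ (Fin l)) θ₀)}

theorem argmax_aux {l : ℕ} (θ₀ ε : ℝ) (hε : 0 < ε)
    (θh p : EuclideanSpace ℝ (Fin l)) (hp : ‖p‖ ≤ θ₀)
    (hproj : ∀ θ : EuclideanSpace ℝ (Fin l), ‖θ‖ ≤ θ₀ → inner ℝ (θ - p) (θh - p) ≤ 0) :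
    argmaxSet θ₀ ε θh = {p} := by
  have hpm : p ∈ Metric.closedBall (0 : EuclideanSpace ℝ (Fin l)) θ₀ := by simpa using hp
  have up : ∀ g : EuclideanSpace ℝ (Fin l),
      sInf ((fun θ => ‖θ - θh‖ ^ 2 - ‖θ - g‖ ^ 2) ''
          Metric.closedBall (0 : EuclideanSpace ℝ (Fin l)) θ₀) ≤
        ‖p - θh‖ ^ 2 - ‖p - g‖ ^ 2 := by
    intro g
    refine csInf_le ⟨-(θ₀ + ‖g‖) ^ 2, ?_⟩ ⟨p, hpm, rfl⟩
    rintro _ ⟨θ, hθ, rfl⟩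
    have h1 : ‖θ‖ ≤ θ₀ := by simpa using hθ
    have h2 : ‖θ - g‖ ≤ θ₀ + ‖g‖ := (norm_sub_le θ g).trans (by linarith)
    have h3 : ‖θ - g‖ ^ 2 ≤ (θ₀ + ‖g‖) ^ 2 := pow_le_pow_left₀ (norm_nonneg _) h2 2
    have h4 := sq_nonneg ‖θ - θh‖
    show -(θ₀ + ‖g‖) ^ 2 ≤ ‖θ - θh‖ ^ 2 - ‖θ - g‖ ^ 2
    linarith
  have lo : ‖p - θh‖ ^ 2 ≤ sInf ((fun θ => ‖θ - θh‖ ^ 2 - ‖θ - p‖ ^ 2) ''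
          Metric.closedBall (0 : EuclideanSpace ℝ (Fin l)) θ₀) := by
    refine le_csInf ⟨_, p, hpm, rfl⟩ ?_
    rintro _ ⟨θ, hθ, rfl⟩
    have h1 := hproj θ (by simpa using hθ)
    have h2 := norm_sub_sq_real (θ - p) (θh - p)
    rw [sub_sub_sub_cancel_right, norm_sub_rev θh p] at h2
    show ‖p - θh‖ ^ 2 ≤ ‖θ - θh‖ ^ 2 - ‖θ - p‖ ^ 2
    linarith
  have hpb : p ∈ Metric.closedBall (0 : EuclideanSpace ℝ (Fin l)) (θ₀ + ε) := by
    simp only [mem_closedBall_zero_iff]; linarith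
  ext g
  simp only [argmaxSet, Set.mem_setOf_eq, Set.mem_singleton_iff]
  constructor
  · rintro ⟨_, h⟩
    have h1 := h p hpb
    have h2 := up g
    have h3 : ‖p - g‖ ^ 2 = 0 := le_antisymm (by linarith) (sq_nonneg _)
    have h4 : ‖p - g‖ = 0 := by simpa using h3
    exact (sub_eq_zero.1 (norm_eq_zero.1 h4)).symm
  · rintro rfl
    refine ⟨hpb, fun g' _ => ?_⟩
    have h2 := up g'
    have h3 := sq_nonneg ‖g - g'‖
    linarith

/-- For every `θ̂` with `‖θ̂‖ ≤ θ₀+ε`, the set of maximizers over the closed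
ball `{g : ‖g‖ ≤ θ₀+ε}` of `g ↦ min_{‖θ‖≤θ₀} (‖θ−θ̂‖² − ‖θ−g‖²)` is the singleton `{θ̂}` if
`‖θ̂‖ ≤ θ₀`, and the singleton `{θ₀ θ̂/‖θ̂‖}` if `‖θ̂‖ > θ₀`. -/
theorem stmt12 {l : ℕ} (hl : 1 ≤ l) (θ₀ ε : ℝ) (hθ₀ : 0 < θ₀) (hε : 0 < ε)
    (θh : EuclideanSpace ℝ (Fin l)) (hθh : ‖θh‖ ≤ θ₀ + ε) :
    (‖θh‖ ≤ θ₀ → argmaxSet θ₀ ε θh = {θh}) ∧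
    (θ₀ < ‖θh‖ → argmaxSet θ₀ ε θh = {(θ₀ / ‖θh‖) • θh}) := by
  constructor
  · intro h
    exact argmax_aux θ₀ ε hε θh θh h (fun θ _ => by simp)
  · intro h
    have hn : 0 < ‖θh‖ := hθ₀.trans h
    refine argmax_aux θ₀ ε hε θh _ ?_ ?_
    · rw [norm_smul, Real.norm_of_nonneg (by positivity), div_mul_cancel₀ _ hn.ne']
    · intro θ hθ
      have e : θh - (θ₀ / ‖θh‖) • θh = (1 - θ₀ / ‖θh‖) • θh := by
        rw [sub_smul, one_smul]
      rw [e, inner_smul_right, inner_sub_left, real_inner_smul_left,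
        real_inner_self_eq_norm_sq]
      have h1 : θ₀ / ‖θh‖ * ‖θh‖ ^ 2 = θ₀ * ‖θh‖ := by field_simp
      have h2 : θ₀ / ‖θh‖ ≤ 1 := (div_le_one hn).2 h.le
      have h3 := real_inner_le_norm θ θh
      have h4 : ‖θ‖ * ‖θh‖ ≤ θ₀ * ‖θh‖ := mul_le_mul_of_nonneg_right hθ hn.le
      rw [h1]
      exact mul_nonpos_of_nonneg_of_nonpos (by linarith) (by linarith)
end

section
/- For every θ ∈ ℝ^ℓ with ‖θ‖ ≤ θ₀ and every η, θ̂ ∈ ℝ^ℓ, it holds that (θ−θ̂)ᵀ Proj(η,θ̂) ≥ (θ−θ̂)ᵀ η. -/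
open scoped RealInnerProductSpace

/-- `p(θ̂) := (‖θ̂‖² − θ₀²)/(ε² + 2εθ₀)`. -/
noncomputable def pFun {l : ℕ} (θ₀ ε : ℝ) (θh : EuclideanSpace ℝ (Fin l)) : ℝ :=
  (‖θh‖ ^ 2 - θ₀ ^ 2) / (ε ^ 2 + 2 * ε * θ₀)

/-- The projection operator
`Proj(η,θ̂) := η` if `p(θ̂) ≤ 0` or `θ̂ᵀη ≤ 0`, and
`Proj(η,θ̂) := η − p(θ̂)·(θ̂ᵀη/‖θ̂‖²)·θ̂` otherwise. -/
noncomputable def Proj {l : ℕ} (θ₀ ε : ℝ)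
    (η θh : EuclideanSpace ℝ (Fin l)) : EuclideanSpace ℝ (Fin l) :=
  if pFun θ₀ ε θh ≤ 0 ∨ ⟪θh, η⟫ ≤ 0 then η
  else η - (pFun θ₀ ε θh * (⟪θh, η⟫ / ‖θh‖ ^ 2)) • θh

/-- For every `θ ∈ ℝˡ` with `‖θ‖ ≤ θ₀` and every `η, θ̂ ∈ ℝˡ`,
`(θ−θ̂)ᵀ Proj(η,θ̂) ≥ (θ−θ̂)ᵀ η`. -/
theorem stmt13 {l : ℕ} (θ₀ ε : ℝ) (hθ₀ : 0 < θ₀) (hε : 0 < ε) :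
    ∀ θ : EuclideanSpace ℝ (Fin l), ‖θ‖ ≤ θ₀ →
    ∀ η θh : EuclideanSpace ℝ (Fin l),
      ⟪θ - θh, η⟫ ≤ ⟪θ - θh, Proj θ₀ ε η θh⟫ := by
  intro θ hθ η θh
  unfold Proj
  split_ifs with h
  · exact le_rfl
  · push Not at h
    obtain ⟨hp, hi⟩ := h
    rw [inner_sub_right, inner_smul_right]
    have hd : 0 < ε ^ 2 + 2 * ε * θ₀ := by positivity
    have hn : θ₀ ^ 2 < ‖θh‖ ^ 2 := by
      by_contra hc
      have : pFun θ₀ ε θh ≤ 0 :=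
        div_nonpos_of_nonpos_of_nonneg (by linarith) hd.le
      linarith
    have hlt : θ₀ < ‖θh‖ := lt_of_pow_lt_pow_left₀ 2 (norm_nonneg _) hn
    have h1 : ⟪θ - θh, θh⟫ ≤ 0 := by
      rw [inner_sub_left, real_inner_self_eq_norm_sq]
      have := real_inner_le_norm θ θh
      nlinarith [norm_nonneg θh]
    have h2 : 0 ≤ pFun θ₀ ε θh * (⟪θh, η⟫ / ‖θh‖ ^ 2) :=
      mul_nonneg hp.le (div_nonneg hi.le (sq_nonneg _))
    have := mul_nonpos_of_nonneg_of_nonpos h2 h1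
    linarith
end

section
/- For every (x,ξ₁,u) ∈ ℝ^n × S × ℝ^p: (i) the minimum over (g₁,g_u) ∈ Q_{c,2}(x,ξ₁,u) of V₂(x,g₁,g_u) equals the minimum over g₁ ∈ Q_{c,1}(x,ξ₁) of V₁(x,g₁); (ii) the set of minimizers equals {(g₁, κ₁(x,g₁)) : g₁ minimizes V₁(x,·) over Q_{c,1}(x,ξ₁)}; and (iii) the synergy gap decomposes as μ_{V₂}(x,ξ₁,u) = μ_{V₁}(x,ξ₁) + (1/2)(u−κ₁(x,ξ₁))ᵀΓ₂⁻¹(u−κ₁(x,ξ₁)), where μ_{V₂}(x,ξ₁,u) := V₂(x,ξ₁,u) − min_{Q_{c,2}(x,ξ₁,u)} V₂(x,·,·) and μ_{V₁}(x,ξ₁) := V₁(x,ξ₁) − min_{Q_{c,1}(x,ξ₁)} V₁(x,·). -/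
open scoped ENNReal
open Matrix

/-- The backstepping Lyapunov function
`V₂(x,ξ₁,u) := V₁(x,ξ₁) + (1/2)(u−κ₁(x,ξ₁))ᵀ Γ₂⁻¹ (u−κ₁(x,ξ₁))`. -/
noncomputable def V2fun {n k p : ℕ}
    (V₁ : (Fin n → ℝ) × (Fin k → ℝ) → ℝ≥0∞)
    (κ₁ : (Fin n → ℝ) × (Fin k → ℝ) → (Fin p → ℝ))
    (Γ₂ : Matrix (Fin p) (Fin p) ℝ)
    (x : Fin n → ℝ) (ξ : Fin k → ℝ) (u : Fin p → ℝ) : ℝ≥0∞ :=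
  V₁ (x, ξ) + ENNReal.ofReal
    ((1 / 2) * ((u - κ₁ (x, ξ)) ⬝ᵥ (Γ₂⁻¹).mulVec (u - κ₁ (x, ξ))))

/-- The backstepping jump constraint set
`Q_{c,2}(x,ξ₁,u) := {(g₁, κ₁(x,g₁)) : g₁ ∈ Q_{c,1}(x,ξ₁)}`. -/
def Qc2 {n k p : ℕ}
    (Qc1 : (Fin n → ℝ) × (Fin k → ℝ) → Set (Fin k → ℝ))
    (κ₁ : (Fin n → ℝ) × (Fin k → ℝ) → (Fin p → ℝ))
    (x : Fin n → ℝ) (ξ : Fin k → ℝ) : Set ((Fin k → ℝ) × (Fin p → ℝ)) :=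
  (fun g => (g, κ₁ (x, g))) '' Qc1 (x, ξ)

/-- For every `(x,ξ₁,u) ∈ ℝⁿ × S × ℝᵖ`: (i) the minimum of `V₂(x,·,·)` over
`Q_{c,2}(x,ξ₁,u)` equals the minimum of `V₁(x,·)` over `Q_{c,1}(x,ξ₁)`; (ii) the set of
minimizers equals `{(g₁, κ₁(x,g₁)) : g₁ minimizes V₁(x,·) over Q_{c,1}(x,ξ₁)}`; (iii) the
synergy gap decomposes as
`μ_{V₂}(x,ξ₁,u) = μ_{V₁}(x,ξ₁) + (1/2)(u−κ₁(x,ξ₁))ᵀΓ₂⁻¹(u−κ₁(x,ξ₁))`. -/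
theorem stmt16 {n k p : ℕ}
    (S : Set (Fin k → ℝ)) (hSne : S.Nonempty)
    (V₁ : (Fin n → ℝ) × (Fin k → ℝ) → ℝ≥0∞)
    (Qc1 : (Fin n → ℝ) × (Fin k → ℝ) → Set (Fin k → ℝ))
    (hQc1sub : ∀ (x : Fin n → ℝ), ∀ ξ ∈ S, Qc1 (x, ξ) ⊆ S)
    (hQc1ne : ∀ (x : Fin n → ℝ), ∀ ξ ∈ S, (Qc1 (x, ξ)).Nonempty)
    (hQc1min : ∀ (x : Fin n → ℝ), ∀ ξ ∈ S, ∃ g ∈ Qc1 (x, ξ),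
      V₁ (x, g) ≠ ⊤ ∧ ∀ g' ∈ Qc1 (x, ξ), V₁ (x, g) ≤ V₁ (x, g'))
    (κ₁ : (Fin n → ℝ) × (Fin k → ℝ) → (Fin p → ℝ))
    (Γ₂ : Matrix (Fin p) (Fin p) ℝ) (hΓ₂ : Γ₂.PosDef) :
    ∀ (x : Fin n → ℝ), ∀ ξ ∈ S, ∀ u : Fin p → ℝ,
      -- (i)
      (⨅ q ∈ Qc2 Qc1 κ₁ x ξ, V2fun V₁ κ₁ Γ₂ x q.1 q.2) =
          (⨅ g ∈ Qc1 (x, ξ), V₁ (x, g)) ∧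
      -- (ii)
      {q ∈ Qc2 Qc1 κ₁ x ξ | V2fun V₁ κ₁ Γ₂ x q.1 q.2 =
            ⨅ q' ∈ Qc2 Qc1 κ₁ x ξ, V2fun V₁ κ₁ Γ₂ x q'.1 q'.2}
        = (fun g => (g, κ₁ (x, g))) ''
            {g ∈ Qc1 (x, ξ) | V₁ (x, g) = ⨅ g' ∈ Qc1 (x, ξ), V₁ (x, g')} ∧
      -- (iii)
      (V2fun V₁ κ₁ Γ₂ x ξ u : EReal) -
          ((⨅ q ∈ Qc2 Qc1 κ₁ x ξ, V2fun V₁ κ₁ Γ₂ x q.1 q.2 : ℝ≥0∞) : EReal)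
        = ((V₁ (x, ξ) : EReal) - ((⨅ g ∈ Qc1 (x, ξ), V₁ (x, g) : ℝ≥0∞) : EReal)) +
            (((1 / 2) * ((u - κ₁ (x, ξ)) ⬝ᵥ (Γ₂⁻¹).mulVec (u - κ₁ (x, ξ))) : ℝ) : EReal) := by
  intro x ξ hξ u
  have hV : ∀ g, V2fun V₁ κ₁ Γ₂ x g (κ₁ (x, g)) = V₁ (x, g) := by
    intro g
    simp [V2fun]
  have h1 : (⨅ q ∈ Qc2 Qc1 κ₁ x ξ, V2fun V₁ κ₁ Γ₂ x q.1 q.2) =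
      (⨅ g ∈ Qc1 (x, ξ), V₁ (x, g)) := by
    rw [Qc2, iInf_image]
    simp only [hV]
  have hc : 0 ≤ (1 / 2) * ((u - κ₁ (x, ξ)) ⬝ᵥ (Γ₂⁻¹).mulVec (u - κ₁ (x, ξ))) := by
    have h := hΓ₂.inv.posSemidef.dotProduct_mulVec_nonneg (u - κ₁ (x, ξ))
    simp only [star_trivial] at h
    positivity
  refine ⟨h1, ?_, ?_⟩
  · rw [h1]
    ext q
    constructor
    · rintro ⟨⟨g, hg, rfl⟩, h⟩
      exact ⟨g, ⟨hg, (hV g).symm.trans h⟩, rfl⟩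
    · rintro ⟨g, ⟨hg, h⟩, rfl⟩
      exact ⟨⟨g, hg, rfl⟩, (hV g).trans h⟩
  · rw [h1, V2fun, EReal.coe_ennreal_add, EReal.coe_ennreal_ofReal, max_eq_left hc,
      sub_eq_add_neg, add_right_comm]
    simp only [sub_eq_add_neg]
end

section
/- The function V is continuous as a map into [0,∞], V(x) = 0 if and only if x = x* (positive definiteness relative to {x*}), and the sublevel set {x ∈ ℝ × S¹ : V(x) ≤ c} is compact for every c ∈ [0,∞). -/
open scoped ENNReal

/-- The unit circle `S¹ = {(x₂,x₃) : x₂² + x₃² = 1} ⊆ ℝ²`. -/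
def circleSet : Set (ℝ × ℝ) := {v | v.1 ^ 2 + v.2 ^ 2 = 1}

/-- The chart domain `U_q := {(x₁,(x₂,x₃)) ∈ ℝ × S¹ : q·x₃ ≠ 1}`. -/
def Uq (q : ℝ) : Set (ℝ × (ℝ × ℝ)) := {p | p.2 ∈ circleSet ∧ q * p.2.2 ≠ 1}

/-- The extended-real-valued function `V(x) := (1/2)‖φ_q(x) − φ_q(x*)‖²` (Euclidean norm,
written out in coordinates) for `x ∈ U_q` and `V(x) := +∞` otherwise. -/
noncomputable def Vq (q : ℝ) (xs : ℝ × (ℝ × ℝ)) (x : ℝ × (ℝ × ℝ)) : ℝ≥0∞ :=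
  if q * x.2.2 = 1 then ⊤
  else ENNReal.ofReal ((1 / 2) * ((x.1 - xs.1) ^ 2 +
    (x.2.1 / (1 - q * x.2.2) - xs.2.1 / (1 - q * xs.2.2)) ^ 2))

open Filter Topology

theorem chart_sq (q a b : ℝ) (hq : q = 1 ∨ q = -1) (h : a ^ 2 + b ^ 2 = 1) (hb : q * b ≠ 1) :
    (a / (1 - q * b)) ^ 2 * (1 - q * b) = 1 + q * b := by
  have h1 : 1 - q * b ≠ 0 := fun h => hb (by linarith)
  have hq2 : q ^ 2 = 1 := by rcases hq with rfl | rfl <;> norm_num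
  rw [div_pow, div_mul_eq_mul_div, div_eq_iff (pow_ne_zero 2 h1)]
  have : a ^ 2 = (1 - q * b) * (1 + q * b) := by
    have : (q * b) ^ 2 = b ^ 2 := by rw [mul_pow, hq2, one_mul]
    nlinarith
  rw [this]; ring

theorem chart_lt (q a b : ℝ) (hq : q = 1 ∨ q = -1) (h : a ^ 2 + b ^ 2 = 1) (hb : q * b ≠ 1) :
    0 < 1 - q * b := by
  have : q * b ≤ 1 := by rcases hq with rfl | rfl <;> nlinarith [sq_nonneg a]
  have := lt_of_le_of_ne this hb
  linarith

theorem Vq_cont (q : ℝ) (hq : q = 1 ∨ q = -1) (xs : ℝ × (ℝ × ℝ)) :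
    ContinuousOn (Vq q xs) {p : ℝ × (ℝ × ℝ) | p.2 ∈ circleSet} := by
  intro x hx
  by_cases ht : q * x.2.2 = 1
  · have hV : Vq q xs x = ⊤ := by simp [Vq, ht]
    unfold ContinuousWithinAt
    rw [hV, ENNReal.tendsto_nhds_top_iff_nat]
    intro n
    set A := xs.2.1 / (1 - q * xs.2.2) with hA
    have hK : 0 < 4 * (n : ℝ) + 2 * A ^ 2 + 2 := by positivity
    have hc : Tendsto (fun y : ℝ × (ℝ × ℝ) => (1 - q * y.2.2) * (4 * (n : ℝ) + 2 * A ^ 2 + 2))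
        (𝓝[{p : ℝ × (ℝ × ℝ) | p.2 ∈ circleSet}] x) (𝓝 0) := by
      have : Continuous (fun y : ℝ × (ℝ × ℝ) => (1 - q * y.2.2) * (4 * (n : ℝ) + 2 * A ^ 2 + 2)) := by
        fun_prop
      have h := (this.tendsto x).mono_left
        (nhdsWithin_le_nhds (s := {p : ℝ × (ℝ × ℝ) | p.2 ∈ circleSet}))
      simpa [ht] using h
    filter_upwards [hc.eventually (gt_mem_nhds one_pos), self_mem_nhdsWithin] with y hy hyc
    unfold Vq
    split_ifs with hty
    · exact ENNReal.natCast_lt_top n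
    · have hpos := chart_lt q y.2.1 y.2.2 hq hyc hty
      have hsq := chart_sq q y.2.1 y.2.2 hq hyc hty
      rw [← ENNReal.ofReal_natCast, ENNReal.ofReal_lt_ofReal_iff_of_nonneg (by positivity)]
      rw [← hA]
      generalize y.2.1 / (1 - q * y.2.2) = u at *
      have hu : 4 * (n : ℝ) + 2 * A ^ 2 < u ^ 2 := by
        by_contra hcon
        push Not at hcon
        nlinarith [mul_le_mul_of_nonneg_right hcon hpos.le]
      nlinarith [sq_nonneg (y.1 - xs.1), sq_nonneg (u - 2 * A)]
  · have hev : ∀ᶠ y in 𝓝 x, q * y.2.2 ≠ 1 := by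
      have : Continuous (fun y : ℝ × (ℝ × ℝ) => q * y.2.2) := by fun_prop
      exact this.continuousAt.eventually_ne ht
    apply ContinuousAt.continuousWithinAt
    have h1 : 1 - q * x.2.2 ≠ 0 := fun h => ht (by linarith)
    have hc : ContinuousAt (fun y : ℝ × (ℝ × ℝ) => ENNReal.ofReal ((1 / 2) * ((y.1 - xs.1) ^ 2 +
        (y.2.1 / (1 - q * y.2.2) - xs.2.1 / (1 - q * xs.2.2)) ^ 2))) x := by
      apply ENNReal.continuous_ofReal.continuousAt.comp
      fun_prop (disch := assumption)
    refine hc.congr ?_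
    filter_upwards [hev] with y hy
    simp [Vq, hy]

/-- With `q ∈ {−1,1}` and `x* ∈ U_q`, the function `V`, equal to
`(1/2)‖φ_q(x) − φ_q(x*)‖²` on `U_q` and `+∞` off `U_q`, is continuous on `ℝ × S¹` as a map
into `[0,∞]`, vanishes exactly at `x*` (positive definiteness relative to `{x*}`), and has
compact sublevel sets `{x ∈ ℝ × S¹ : V(x) ≤ c}` for every finite `c`. -/
theorem stmt19 (q : ℝ) (hq : q = 1 ∨ q = -1)
    (xs : ℝ × (ℝ × ℝ)) (hxs : xs ∈ Uq q) :
    ContinuousOn (Vq q xs) {p : ℝ × (ℝ × ℝ) | p.2 ∈ circleSet} ∧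
    (∀ x ∈ {p : ℝ × (ℝ × ℝ) | p.2 ∈ circleSet}, (Vq q xs x = 0 ↔ x = xs)) ∧
    ∀ c : ℝ≥0∞, c ≠ ⊤ →
      IsCompact {x | x.2 ∈ circleSet ∧ Vq q xs x ≤ c} := by
  have hcont := Vq_cont q hq xs
  have hq0 : q ≠ 0 := by rcases hq with rfl | rfl <;> norm_num
  have hcl : IsClosed {p : ℝ × (ℝ × ℝ) | p.2 ∈ circleSet} := by
    have : Continuous (fun p : ℝ × (ℝ × ℝ) => p.2.1 ^ 2 + p.2.2 ^ 2) := by fun_prop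
    exact isClosed_eq this continuous_const
  refine ⟨hcont, ?_, ?_⟩
  · intro x hx
    obtain ⟨hsc, hst⟩ := hxs
    constructor
    · intro h
      unfold Vq at h
      split_ifs at h with ht
      · exact absurd h ENNReal.top_ne_zero
      have hs1 := chart_sq q x.2.1 x.2.2 hq hx ht
      have hs2 := chart_sq q xs.2.1 xs.2.2 hq hsc hst
      have hp1 := chart_lt q x.2.1 x.2.2 hq hx ht
      have hp2 := chart_lt q xs.2.1 xs.2.2 hq hsc hst
      rw [ENNReal.ofReal_eq_zero] at h
      have e1 : x.1 = xs.1 := by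
        have : (x.1 - xs.1) ^ 2 = 0 := by
          apply le_antisymm _ (sq_nonneg _)
          nlinarith [sq_nonneg (x.2.1 / (1 - q * x.2.2) - xs.2.1 / (1 - q * xs.2.2))]
        have := pow_eq_zero_iff (two_ne_zero) |>.1 this
        linarith
      have e2 : x.2.1 / (1 - q * x.2.2) = xs.2.1 / (1 - q * xs.2.2) := by
        have : (x.2.1 / (1 - q * x.2.2) - xs.2.1 / (1 - q * xs.2.2)) ^ 2 = 0 := by
          apply le_antisymm _ (sq_nonneg _)
          nlinarith [sq_nonneg (x.1 - xs.1)]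
        have := pow_eq_zero_iff (two_ne_zero) |>.1 this
        linarith
      have e3 : q * x.2.2 = q * xs.2.2 := by
        rw [e2] at hs1
        generalize xs.2.1 / (1 - q * xs.2.2) = u at *
        have : (u ^ 2 + 1) * (q * x.2.2 - q * xs.2.2) = 0 := by linarith
        rcases mul_eq_zero.1 this with h | h
        · nlinarith [sq_nonneg u]
        · linarith
      rw [e3] at e2
      have e4 := (div_left_inj' hp2.ne').1 e2
      exact Prod.ext e1 (Prod.ext e4 (mul_left_cancel₀ hq0 e3))
    · rintro rfl
      simp [Vq, hst]
  · intro c hc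
    have hclosed : IsClosed {x | x.2 ∈ circleSet ∧ Vq q xs x ≤ c} :=
      hcont.preimage_isClosed_of_isClosed hcl isClosed_Iic
    have hK : IsCompact ((Set.Icc (xs.1 - (2 * c.toReal + 1)) (xs.1 + (2 * c.toReal + 1))) ×ˢ
        ((Set.Icc (-1 : ℝ) 1) ×ˢ (Set.Icc (-1 : ℝ) 1))) :=
      isCompact_Icc.prod (isCompact_Icc.prod isCompact_Icc)
    refine hK.of_isClosed_subset hclosed ?_
    rintro x ⟨hx, hV⟩
    have hx' : x.2.1 ^ 2 + x.2.2 ^ 2 = 1 := hx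
    unfold Vq at hV
    split_ifs at hV with ht
    · exact absurd (top_le_iff.1 hV) hc
    rw [ENNReal.ofReal_le_iff_le_toReal hc] at hV
    have hc0 : 0 ≤ c.toReal := ENNReal.toReal_nonneg
    have h1 : (x.1 - xs.1) ^ 2 ≤ 2 * c.toReal := by
      nlinarith [sq_nonneg (x.2.1 / (1 - q * x.2.2) - xs.2.1 / (1 - q * xs.2.2))]
    refine ⟨⟨?_, ?_⟩, ⟨?_, ?_⟩, ⟨?_, ?_⟩⟩ <;>
      nlinarith [sq_nonneg (x.1 - xs.1 - 1), sq_nonneg (x.1 - xs.1 + 1), sq_nonneg x.2.1,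
        sq_nonneg x.2.2]
end
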